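/- arXiv:1904.02890 — 2 statements merged into one kernel-verified Lean document; each statement's English description precedes it below -/
import Mathlib

section
/- A random vector X = (X₁,…,X_d) in ℝ^d is centered Gaussian with covariance matrix Σ if and only if for all smooth compactly supported f : ℝ^d → ℝ: E[Σᵢ Xᵢ ∂f/∂xᵢ(X)] = E[Σᵢⱼ Σᵢⱼ ∂²f/∂xᵢ∂xⱼ(X)]. -/
open MeasureTheory Set
open scoped FourierTransform SchwartzMap LineDeriv

lemma schwartz_repr {V : Type*} [NormedAddCommGroup V] [InnerProductSpace ℝ V] [FiniteDimensional ℝ V]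
   [MeasurableSpace V] [BorelSpace V] (G : 𝓢(V, ℂ)) (x : V) :
   G x = ∫ ξ, Complex.exp (Complex.I * ((2 * Real.pi * inner ℝ ξ x : ℝ) : ℂ)) * (𝓕 G) ξ := by
  have h : 𝓕⁻ (𝓕 G) = G := FourierTransform.fourierInv_fourier_eq G
  conv_lhs => rw [← h]
  rw [SchwartzMap.fourierInv_coe, Real.fourierInv_eq']
  congr 1 with ξ
  rw [smul_eq_mul, mul_comm Complex.I]

lemma fourier_deriv {V : Type*} [NormedAddCommGroup V] [InnerProductSpace ℝ V] [FiniteDimensional ℝ V]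
   [MeasurableSpace V] [BorelSpace V] (G : 𝓢(V, ℂ)) (v ξ : V) :
   (𝓕 (∂_{v} G)) ξ = (2 * Real.pi * Complex.I) * ((inner ℝ ξ v : ℝ) : ℂ) * 𝓕 G ξ := by
  rw [SchwartzMap.fourier_lineDerivOp_eq]
  rw [smul_apply, SchwartzMap.smulLeftCLM_apply_apply (by fun_prop)]
  simp [mul_assoc]

lemma fin_repr {d : ℕ} (f : (Fin d → ℝ) → ℝ) (hf : ContDiff ℝ (⊤ : ℕ∞) f) (hc : HasCompactSupport f) :
    ∃ H : 𝓢(EuclideanSpace ℝ (Fin d), ℂ),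
     (∀ x v : Fin d → ℝ, ((fderiv ℝ f x v : ℝ) : ℂ) =
       ∫ ξ : EuclideanSpace ℝ (Fin d), Complex.exp (Complex.I * ((∑ i, (2 * Real.pi * ξ i) * x i : ℝ) : ℂ)) *
         (Complex.I * ((∑ i, (2 * Real.pi * ξ i) * v i : ℝ) : ℂ) * H ξ)) ∧
     (∀ x v w : Fin d → ℝ, ((fderiv ℝ (fun y => fderiv ℝ f y w) x v : ℝ) : ℂ) =
       ∫ ξ : EuclideanSpace ℝ (Fin d), Complex.exp (Complex.I * ((∑ i, (2 * Real.pi * ξ i) * x i : ℝ) : ℂ)) *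
         (-((∑ i, (2 * Real.pi * ξ i) * v i : ℝ) : ℂ) * ((∑ i, (2 * Real.pi * ξ i) * w i : ℝ) : ℂ) * H ξ)) := by
  let e : EuclideanSpace ℝ (Fin d) ≃L[ℝ] (Fin d → ℝ) := EuclideanSpace.equiv (Fin d) ℝ
  let g : EuclideanSpace ℝ (Fin d) → ℂ := fun x => ((f (e x) : ℝ) : ℂ)
  have hg : ContDiff ℝ (⊤ : ℕ∞) g := Complex.ofRealCLM.contDiff.comp (hf.comp e.contDiff)
  have hgc : HasCompactSupport g := 
    (hc.comp_homeomorph e.toHomeomorph).comp_left (g := fun r : ℝ => (r : ℂ)) (by simp)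
  let G : 𝓢(EuclideanSpace ℝ (Fin d), ℂ) := hgc.toSchwartzMap hg
  have hG : ∀ x, G x = ((f (e x) : ℝ) : ℂ) := fun x => rfl
  have key : ∀ (K : 𝓢(EuclideanSpace ℝ (Fin d), ℂ)) (k : (Fin d → ℝ) → ℝ), ContDiff ℝ (⊤ : ℕ∞) k →
      (∀ x, K x = ((k (e x) : ℝ) : ℂ)) → 
      ∀ v x, (∂_{e.symm v} K) x = ((fderiv ℝ k (e x) v : ℝ) : ℂ) := by
    intro K k hk hK v x
    rw [SchwartzMap.lineDerivOp_apply_eq_fderiv]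
    have h1 : HasFDerivAt k (fderiv ℝ k (e x)) (e x) := (hk.differentiable (by simp) _).hasFDerivAt
    have h2 := (Complex.ofRealCLM.hasFDerivAt.comp x (h1.comp x e.hasFDerivAt))
    have : (K : EuclideanSpace ℝ (Fin d) → ℂ) = fun x => ((k (e x) : ℝ) : ℂ) := funext hK
    rw [this]
    erw [h2.fderiv]
    simp
  have hin : ∀ (ξ : EuclideanSpace ℝ (Fin d)) (v : Fin d → ℝ), 
     2 * Real.pi * inner ℝ ξ (e.symm v) = ∑ i, (2 * Real.pi * ξ i) * v i := by
    intro ξ v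
    simp [PiLp.inner_apply, Finset.mul_sum, e, mul_assoc, mul_comm, mul_left_comm]
  have hin' : ∀ (ξ : EuclideanSpace ℝ (Fin d)) (v : Fin d → ℝ), 
     2 * (Real.pi : ℂ) * ((inner ℝ ξ (e.symm v) : ℝ) : ℂ) = ((∑ i, (2 * Real.pi * ξ i) * v i : ℝ) : ℂ) := by
    intro ξ v
    rw [← hin]; push_cast; rfl
  refine ⟨𝓕 G, fun x v => ?_, fun x v w => ?_⟩
  · have := key G f hf hG v (e.symm x)
    rw [e.apply_symm_apply] at this
    rw [← this, schwartz_repr]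
    congr 1 with ξ
    rw [fourier_deriv, hin, ← hin' ξ v]
    ring
  · have hk : ContDiff ℝ (⊤ : ℕ∞) (fun y => fderiv ℝ f y w) := 
      (hf.fderiv_right (m := (⊤ : ℕ∞)) (by simp)).clm_apply contDiff_const
    have := key (∂_{e.symm w} G) _ hk (key G f hf hG w) v (e.symm x)
    rw [e.apply_symm_apply] at this
    rw [← this, schwartz_repr]
    congr 1 with ξ
    rw [fourier_deriv, fourier_deriv, hin, ← hin' ξ v, ← hin' ξ w]
    linear_combination (4 * Real.pi^2 * (inner ℝ ξ (e.symm v) : ℝ) * (inner ℝ ξ (e.symm w) : ℝ) * (𝓕 G) ξ * Complex.exp (Complex.I * ((∑ i, (2 * Real.pi * ξ i) * x i : ℝ) : ℂ))) * Complex.I_sq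

lemma char_ident {Ω : Type*} [MeasurableSpace Ω] (P : Measure Ω) [IsProbabilityMeasure P]
    (Y : Ω → ℝ) (hY : Measurable Y) (hYi : Integrable Y P) (q : ℝ)
    (h : ∀ t : ℝ, ∫ ω, Complex.exp (Complex.I * ((t * Y ω : ℝ) : ℂ)) ∂P =
      Complex.exp (-(1/2 : ℂ) * ((t ^ 2 * q : ℝ) : ℂ))) :
    ∫ ω, Complex.exp (Complex.I * (Y ω : ℂ)) * (Complex.I * (Y ω : ℂ)) ∂P =
      - (q : ℂ) * ∫ ω, Complex.exp (Complex.I * (Y ω : ℂ)) ∂P := by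
  have h0 := (hasDerivAt_integral_of_dominated_loc_of_deriv_le (μ := P) (x₀ := (1 : ℝ)) (s := univ)
    (F := fun (t : ℝ) ω => Complex.exp (Complex.I * ((t * Y ω : ℝ) : ℂ)))
    (F' := fun (t : ℝ) ω => Complex.exp (Complex.I * ((t * Y ω : ℝ) : ℂ)) * (Complex.I * (Y ω : ℂ)))
    (bound := fun ω => ‖Y ω‖) Filter.univ_mem
    (Filter.Eventually.of_forall fun t => (by fun_prop : Measurable _).aestronglyMeasurable)
    ?_ (by fun_prop : Measurable _).aestronglyMeasurable ?_ hYi.norm ?_).2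
  · have h1 : HasDerivAt (fun t : ℝ => ∫ ω, Complex.exp (Complex.I * ((t * Y ω : ℝ) : ℂ)) ∂P)
       (Complex.exp (-(1/2 : ℂ) * (((1:ℝ) ^ 2 * q : ℝ) : ℂ)) * (-(1/2 : ℂ) * ((2 * 1 * q : ℝ) : ℂ))) 1 := by
      simp_rw [h]
      have h2 : HasDerivAt (fun t : ℝ => t ^ 2 * q) (2 * 1 * q) 1 := by
        simpa using ((hasDerivAt_id (1:ℝ)).pow 2).mul_const q
      exact ((h2.ofReal_comp).const_mul (-(1/2 : ℂ))).cexp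
    have h3 := h0.unique h1
    have h4 := h 1
    simp only [one_mul] at h3 h4
    rw [h3, h4]
    push_cast
    ring
  · apply Integrable.of_bound (C := 1) (by fun_prop : Measurable _).aestronglyMeasurable
    refine Filter.Eventually.of_forall fun ω => ?_
    rw [mul_comm, Complex.norm_exp_ofReal_mul_I]
  · refine Filter.Eventually.of_forall fun ω t _ => ?_
    rw [norm_mul, mul_comm Complex.I, Complex.norm_exp_ofReal_mul_I]
    simp
  · refine Filter.Eventually.of_forall fun ω t _ => ?_
    have h2 : HasDerivAt (fun t : ℝ => t * Y ω) (Y ω) t := by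
      simpa using (hasDerivAt_id t).mul_const (Y ω)
    exact ((h2.ofReal_comp).const_mul Complex.I).cexp

lemma coord_integrable {Ω : Type*} [MeasurableSpace Ω] (P : Measure Ω) [IsProbabilityMeasure P]
    (d : ℕ) (X : Ω → (Fin d → ℝ)) (hXmeas : Measurable X)
    (hX2 : Integrable (fun ω => ∑ i, (X ω i) ^ 2) P) (i : Fin d) : Integrable (fun ω => X ω i) P := by
  refine (hX2.add (integrable_const (1:ℝ))).mono' (by fun_prop : Measurable _).aestronglyMeasurable ?_
  refine Filter.Eventually.of_forall fun ω => ?_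
  have : (X ω i)^2 ≤ ∑ i, (X ω i) ^ 2 :=
    Finset.single_le_sum (f := fun i => (X ω i)^2) (fun _ _ => sq_nonneg _) (Finset.mem_univ i)
  simp only [Pi.add_apply, Real.norm_eq_abs]
  have h2 := sq_abs (X ω i)
  nlinarith [sq_nonneg (|X ω i| - 1), abs_nonneg (X ω i)]

lemma fderiv_sum_eq {d : ℕ} (L : (Fin d → ℝ) →L[ℝ] ℝ) (x : Fin d → ℝ) :
    ∑ i, x i * L (Pi.single i 1) = L x := by
  have := LinearMap.pi_apply_eq_sum_univ (L : (Fin d → ℝ) →ₗ[ℝ] ℝ) x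
  simp only [ContinuousLinearMap.coe_coe, smul_eq_mul] at this
  rw [this]
  congr 1 with i
  congr 2
  ext j
  simp [Pi.single_apply, eq_comm]

lemma forward {Ω : Type*} [MeasurableSpace Ω] (P : Measure Ω) [IsProbabilityMeasure P]
    (d : ℕ) (X : Ω → (Fin d → ℝ)) (hXmeas : Measurable X)
    (hX2 : Integrable (fun ω => ∑ i, (X ω i) ^ 2) P)
    (S : Matrix (Fin d) (Fin d) ℝ) 
    (h : ∀ θ : Fin d → ℝ,
        (∫ ω, Complex.exp (Complex.I * ((∑ i, θ i * X ω i : ℝ) : ℂ)) ∂P) =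
          Complex.exp (-(1/2 : ℂ) * ((∑ i, ∑ j, θ i * S i j * θ j : ℝ) : ℂ)))
    (f : (Fin d → ℝ) → ℝ) (hf : ContDiff ℝ (⊤ : ℕ∞) f) (hc : HasCompactSupport f) :
        (∫ ω, ∑ i, X ω i * fderiv ℝ f (X ω) (Pi.single i 1) ∂P) =
          ∫ ω, ∑ i, ∑ j, S i j *
            fderiv ℝ (fun y => fderiv ℝ f y (Pi.single j 1)) (X ω) (Pi.single i 1) ∂P := by
  obtain ⟨H, h1, h2⟩ := fin_repr f hf hc
  have hHm : Measurable H := H.continuous.measurable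
  have hXi := coord_integrable P d X hXmeas hX2
  simp_rw [fderiv_sum_eq]
  set T : Ω → EuclideanSpace ℝ (Fin d) → ℝ := fun ω ξ => ∑ i, (2 * Real.pi * ξ i) * X ω i with hT
  set q : EuclideanSpace ℝ (Fin d) → ℝ := 
    fun ξ => ∑ i, ∑ j, (2 * Real.pi * ξ i) * S i j * (2 * Real.pi * ξ j) with hq
  have hpi : (0:ℝ) ≤ 2 * Real.pi := by positivity
  have hTb : ∀ ω ξ, |T ω ξ| ≤ (∑ i, |X ω i|) * (2 * Real.pi * ‖ξ‖) := by
    intro ω ξ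
    rw [Finset.sum_mul]
    refine (Finset.abs_sum_le_sum_abs _ _).trans (Finset.sum_le_sum fun i _ => ?_)
    rw [abs_mul, abs_mul, abs_of_nonneg hpi, mul_comm]
    gcongr
    exact PiLp.norm_apply_le ξ i
  have hqb : ∀ ξ, |q ξ| ≤ (∑ i, ∑ j, |S i j|) * ((2 * Real.pi) ^ 2 * ‖ξ‖ ^ 2) := by
    intro ξ
    rw [Finset.sum_mul]
    refine (Finset.abs_sum_le_sum_abs _ _).trans (Finset.sum_le_sum fun i _ => ?_)
    rw [Finset.sum_mul]
    refine (Finset.abs_sum_le_sum_abs _ _).trans (Finset.sum_le_sum fun j _ => ?_)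
    have e1 : |ξ i| ≤ ‖ξ‖ := PiLp.norm_apply_le ξ i
    have e2 : |ξ j| ≤ ‖ξ‖ := PiLp.norm_apply_le ξ j
    rw [abs_mul, abs_mul, abs_mul (2 * Real.pi), abs_mul (2 * Real.pi), abs_of_nonneg hpi]
    calc _ = |S i j| * ((2 * Real.pi)^2 * (|ξ i| * |ξ j|)) := by ring
      _ ≤ |S i j| * ((2 * Real.pi)^2 * (‖ξ‖ * ‖ξ‖)) := by gcongr
      _ = _ := by ring
  have hne : ∀ r : ℝ, ‖Complex.exp (Complex.I * (r : ℂ))‖ = 1 := fun r => by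
    rw [mul_comm, Complex.norm_exp_ofReal_mul_I]
  have hTm : Measurable (Function.uncurry T) := by
    simp only [hT, Function.uncurry_def]
    refine Finset.measurable_sum _ fun i _ => ?_
    fun_prop
  have hTm' : Measurable (fun p : Ω × EuclideanSpace ℝ (Fin d) => T p.1 p.2) := hTm
  have hqm : Measurable q := by
    simp only [hq]; fun_prop
  have hq2 : ∀ ξ : EuclideanSpace ℝ (Fin d), ∑ i, ∑ j, S i j * (-(∑ k, (2 * Real.pi * ξ k) * (Pi.single i 1 : Fin d → ℝ) k) * 
      (∑ k, (2 * Real.pi * ξ k) * (Pi.single j 1 : Fin d → ℝ) k)) = - q ξ := by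
    intro ξ
    simp only [hq, Pi.single_apply, mul_ite, mul_one, mul_zero, Finset.sum_ite_eq', Finset.mem_univ, if_true]
    rw [← Finset.sum_neg_distrib]
    refine Finset.sum_congr rfl fun i _ => ?_
    rw [← Finset.sum_neg_distrib]
    refine Finset.sum_congr rfl fun j _ => ?_
    ring
  have hL : ∀ ω, ((fderiv ℝ f (X ω) (X ω) : ℝ) : ℂ) = 
      ∫ ξ, Complex.exp (Complex.I * (T ω ξ : ℂ)) * (Complex.I * (T ω ξ : ℂ) * H ξ) := fun ω => h1 _ _
  have hR : ∀ ω, ((∑ i, ∑ j, S i j *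
            fderiv ℝ (fun y => fderiv ℝ f y (Pi.single j 1)) (X ω) (Pi.single i 1) : ℝ) : ℂ) =
      ∫ ξ, Complex.exp (Complex.I * (T ω ξ : ℂ)) * (-(q ξ : ℂ) * H ξ) := by
    intro ω
    push_cast
    simp_rw [h2]
    have hint : ∀ i j, Integrable (fun ξ : EuclideanSpace ℝ (Fin d) => (S i j : ℂ) * (Complex.exp (Complex.I * (T ω ξ : ℂ)) *
         (-((∑ k, (2 * Real.pi * ξ k) * (Pi.single i 1 : Fin d → ℝ) k : ℝ) : ℂ) * 
         ((∑ k, (2 * Real.pi * ξ k) * (Pi.single j 1 : Fin d → ℝ) k : ℝ) : ℂ) * H ξ))) := by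
      intro i j
      refine Integrable.const_mul ?_ _
      refine ((H.integrable_pow_mul volume 2).const_mul ((2 * Real.pi)^2)).mono' ?_ ?_
      · refine Measurable.aestronglyMeasurable ?_
        simp only [hT]
        fun_prop
      · refine Filter.Eventually.of_forall fun ξ => ?_
        have e1 : |ξ i| ≤ ‖ξ‖ := PiLp.norm_apply_le ξ i
        have e2 : |ξ j| ≤ ‖ξ‖ := PiLp.norm_apply_le ξ j
        simp only [Pi.single_apply, mul_ite, mul_one, mul_zero, Finset.sum_ite_eq', Finset.mem_univ, if_true]
        rw [norm_mul, hne, norm_mul, norm_mul, norm_neg, Complex.norm_real, Complex.norm_real,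
          norm_mul (2 * Real.pi), norm_mul (2 * Real.pi), Real.norm_of_nonneg hpi, Real.norm_eq_abs, Real.norm_eq_abs]
        calc _ = (2 * Real.pi)^2 * ((|ξ i| * |ξ j|) * ‖H ξ‖) := by ring
          _ ≤ (2 * Real.pi)^2 * ((‖ξ‖ * ‖ξ‖) * ‖H ξ‖) := by gcongr
          _ = _ := by ring
    simp_rw [← integral_const_mul]
    have : ∀ i, ∑ j, ∫ ξ : EuclideanSpace ℝ (Fin d), (S i j : ℂ) * (Complex.exp (Complex.I * (T ω ξ : ℂ)) *
         (-((∑ k, (2 * Real.pi * ξ k) * (Pi.single i 1 : Fin d → ℝ) k : ℝ) : ℂ) * 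
         ((∑ k, (2 * Real.pi * ξ k) * (Pi.single j 1 : Fin d → ℝ) k : ℝ) : ℂ) * H ξ)) = 
         ∫ ξ : EuclideanSpace ℝ (Fin d), ∑ j, (S i j : ℂ) * (Complex.exp (Complex.I * (T ω ξ : ℂ)) *
         (-((∑ k, (2 * Real.pi * ξ k) * (Pi.single i 1 : Fin d → ℝ) k : ℝ) : ℂ) * 
         ((∑ k, (2 * Real.pi * ξ k) * (Pi.single j 1 : Fin d → ℝ) k : ℝ) : ℂ) * H ξ)) := 
      fun i => (integral_finsetSum _ fun j _ => hint i j).symm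
    refine (Finset.sum_congr rfl fun i _ => this i).trans ?_
    rw [← integral_finsetSum _ fun i _ => integrable_finsetSum _ fun j _ => hint i j]
    congr 1 with ξ
    rw [← Complex.ofReal_neg, ← hq2 ξ]
    push_cast
    rw [Finset.sum_mul, Finset.mul_sum]
    refine Finset.sum_congr rfl fun i _ => ?_
    rw [Finset.sum_mul, Finset.mul_sum]
    refine Finset.sum_congr rfl fun j _ => ?_
    ring
  have goal : ((∫ ω, fderiv ℝ f (X ω) (X ω) ∂P : ℝ) : ℂ) = ((∫ ω, ∑ i, ∑ j, S i j *
            fderiv ℝ (fun y => fderiv ℝ f y (Pi.single j 1)) (X ω) (Pi.single i 1) ∂P : ℝ) : ℂ) := by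
    rw [← integral_complex_ofReal, ← integral_complex_ofReal]
    simp_rw [hL, hR]
    refine (integral_integral_swap ?_).trans (Eq.trans ?_ (integral_integral_swap ?_).symm)
    rotate_left
    · congr 1 with ξ
      have hch := char_ident P (fun ω => T ω ξ) (by simp only [hT]; fun_prop) 
        (by simp only [hT]; exact integrable_finsetSum _ fun i _ => (hXi i).const_mul _) (q ξ) (by
          intro t
          have := h (fun i => t * (2 * Real.pi * ξ i))
          convert this using 4
          · simp only [hT, Finset.mul_sum]
            congr 2 
            exact Finset.sum_congr rfl fun i _ => by ring
          · simp only [hq, Finset.mul_sum]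
            exact Finset.sum_congr rfl fun i _ => Finset.sum_congr rfl fun j _ => by ring)
      have r1 : ∀ ω, Complex.exp (Complex.I * (T ω ξ : ℂ)) * (Complex.I * (T ω ξ : ℂ) * H ξ) =
          Complex.exp (Complex.I * (T ω ξ : ℂ)) * (Complex.I * (T ω ξ : ℂ)) * H ξ := fun ω => by ring
      simp_rw [r1]
      rw [integral_mul_const, integral_mul_const, hch]
      ring
    · have hb := Integrable.mul_prod (μ := P) (ν := (volume : Measure (EuclideanSpace ℝ (Fin d))))
        (f := fun _ => (1:ℝ)) (integrable_const _) ((H.integrable_pow_mul volume 2).const_mul ((∑ i, ∑ j, |S i j|) * (2 * Real.pi) ^ 2))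
      refine hb.mono' ?_ ?_
      · refine Measurable.aestronglyMeasurable ?_
        simp only [Function.uncurry_def]
        fun_prop
      · refine Filter.Eventually.of_forall fun p => ?_
        simp only [Function.uncurry_def]
        rw [norm_mul, hne, norm_mul, norm_neg, Complex.norm_real, Real.norm_eq_abs, one_mul, one_mul]
        calc _ ≤ ((∑ i, ∑ j, |S i j|) * ((2 * Real.pi) ^ 2 * ‖p.2‖ ^ 2)) * ‖H p.2‖ := by gcongr; exact hqb _
          _ = _ := by ring
    · have hb := Integrable.mul_prod (μ := P) (ν := (volume : Measure (EuclideanSpace ℝ (Fin d))))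
        (f := fun ω => ∑ i, |X ω i|) (integrable_finsetSum _ fun i _ => (hXi i).abs) 
          ((H.integrable_pow_mul volume 1).const_mul (2 * Real.pi))
      refine hb.mono' ?_ ?_
      · refine Measurable.aestronglyMeasurable ?_
        simp only [Function.uncurry_def]
        fun_prop
      · refine Filter.Eventually.of_forall fun p => ?_
        simp only [Function.uncurry_def]
        rw [norm_mul, hne, norm_mul, norm_mul, Complex.norm_I, Complex.norm_real, Real.norm_eq_abs, one_mul, one_mul]
        calc _ ≤ ((∑ i, |X p.1 i|) * (2 * Real.pi * ‖p.2‖)) * ‖H p.2‖ := by gcongr; exact hTb _ _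
          _ = _ := by ring
  exact_mod_cast goal

lemma cos_prod_hasFDerivAt {d : ℕ} (L : (Fin d → ℝ) →L[ℝ] ℝ) (b c : ℝ) (k : (Fin d → ℝ) → ℝ)
    (hk : ContDiff ℝ (⊤ : ℕ∞) k) (x v : Fin d → ℝ) :
    fderiv ℝ (fun y => Real.cos (L y + b) * k (c • y)) x v =
      Real.cos (L x + (b + Real.pi / 2)) * (L v * k (c • x)) +
      Real.cos (L x + b) * (c * fderiv ℝ k (c • x) v) := by
  have h1 : HasFDerivAt k (fderiv ℝ k (c • x)) (c • x) := (hk.differentiable (by simp) _).hasFDerivAt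
  have h2 : HasFDerivAt (fun y : Fin d → ℝ => c • y) (c • ContinuousLinearMap.id ℝ (Fin d → ℝ)) x :=
    (hasFDerivAt_id x).const_smul c
  have h3 := h1.comp x h2
  have h4 := ((L.hasFDerivAt (x := x)).add_const b).cos
  have h5 := h4.mul h3
  erw [h5.fderiv]
  rw [← add_assoc, Real.cos_add_pi_div_two]
  simp
  ring

lemma bdd_of_cpt {d : ℕ} (k : (Fin d → ℝ) → ℝ) (hk : Continuous k) (hc : HasCompactSupport k) :
    ∃ C, ∀ x, |k x| ≤ C := hk.bounded_above_of_compact_support hc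

lemma abs_bound2 (u1 u2 a k c h C1 C2 : ℝ) (h1 : |u1| ≤ 1) (h2 : |u2| ≤ 1) (hc : |c| ≤ 1)
    (hk : |k| ≤ C1) (hh : |h| ≤ C2) : |u1 * (a * k) + u2 * (c * h)| ≤ |a| * C1 + C2 := by
  refine (abs_add_le _ _).trans (add_le_add ?_ ?_)
  · rw [abs_mul, abs_mul]
    calc _ ≤ 1 * (|a| * C1) := by gcongr
      _ = _ := one_mul _
  · rw [abs_mul, abs_mul]
    calc _ ≤ 1 * (1 * C2) := by gcongr
      _ = _ := by ring

lemma limit_ident {Ω : Type*} [MeasurableSpace Ω] (P : Measure Ω) [IsProbabilityMeasure P]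
    (d : ℕ) (X : Ω → (Fin d → ℝ)) (hXmeas : Measurable X)
    (hX2 : Integrable (fun ω => ∑ i, (X ω i) ^ 2) P)
    (S : Matrix (Fin d) (Fin d) ℝ) 
    (h : ∀ f : (Fin d → ℝ) → ℝ, ContDiff ℝ (⊤ : ℕ∞) f → HasCompactSupport f →
        (∫ ω, ∑ i, X ω i * fderiv ℝ f (X ω) (Pi.single i 1) ∂P) =
          ∫ ω, ∑ i, ∑ j, S i j *
            fderiv ℝ (fun y => fderiv ℝ f y (Pi.single j 1)) (X ω) (Pi.single i 1) ∂P)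
    (L : (Fin d → ℝ) →L[ℝ] ℝ) (b : ℝ) :
    ∫ ω, Real.cos (L (X ω) + (b + Real.pi / 2)) * L (X ω) ∂P = 
      - (∑ i, ∑ j, L (Pi.single i 1) * S i j * L (Pi.single j 1)) * ∫ ω, Real.cos (L (X ω) + b) ∂P := by
  have hXi := coord_integrable P d X hXmeas hX2
  let χ : ContDiffBump (0 : Fin d → ℝ) := ⟨1, 2, by norm_num, by norm_num⟩
  let k : (Fin d → ℝ) → ℝ := fun x => χ x
  have hk : ContDiff ℝ (⊤ : ℕ∞) k := χ.contDiff
  have hkc : HasCompactSupport k := χ.hasCompactSupport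
  have hk0 : k 0 = 1 := χ.one_of_mem_closedBall (by simp [χ])
  let k1 : Fin d → (Fin d → ℝ) → ℝ := fun i x => fderiv ℝ k x (Pi.single i 1)
  have hk1 : ∀ i, ContDiff ℝ (⊤ : ℕ∞) (k1 i) := fun i =>
    (hk.fderiv_right (m := (⊤ : ℕ∞)) (by simp)).clm_apply contDiff_const
  have hk1c : ∀ i, HasCompactSupport (k1 i) := fun i => hkc.fderiv_apply (𝕜 := ℝ) _
  let k2 : Fin d → Fin d → (Fin d → ℝ) → ℝ := fun i j x => fderiv ℝ (k1 j) x (Pi.single i 1)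
  have hk2 : ∀ i j, ContDiff ℝ (⊤ : ℕ∞) (k2 i j) := fun i j =>
    ((hk1 j).fderiv_right (m := (⊤ : ℕ∞)) (by simp)).clm_apply contDiff_const
  have hk2c : ∀ i j, HasCompactSupport (k2 i j) := fun i j => (hk1c j).fderiv_apply (𝕜 := ℝ) _
  obtain ⟨C0, hC0⟩ := bdd_of_cpt k hk.continuous hkc
  choose C1 hC1 using fun i => bdd_of_cpt (k1 i) (hk1 i).continuous (hk1c i)
  choose C2 hC2 using fun i j => bdd_of_cpt (k2 i j) (hk2 i j).continuous (hk2c i j)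
  let c : ℕ → ℝ := fun n => 1 / ((n : ℝ) + 1)
  have hc1 : ∀ n, |c n| ≤ 1 := by
    intro n
    rw [abs_of_nonneg (by positivity)]
    exact (div_le_one (by positivity)).2 (by linarith [(Nat.cast_nonneg n : (0:ℝ) ≤ n)])
  have hcpos : ∀ n, 0 < c n := fun n => by positivity
  have hclim : Filter.Tendsto c Filter.atTop (nhds 0) := tendsto_one_div_add_atTop_nhds_zero_nat
  let l : Fin d → ℝ := fun i => L (Pi.single i 1)
  let D1 : ℝ → Fin d → (Fin d → ℝ) → ℝ := fun c i x =>
    Real.cos (L x + (b + Real.pi / 2)) * (l i * k (c • x)) + Real.cos (L x + b) * (c * k1 i (c • x))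
  let D2 : ℝ → Fin d → Fin d → (Fin d → ℝ) → ℝ := fun c i j x =>
    (Real.cos (L x + (b + Real.pi / 2 + Real.pi / 2)) * (l i * k (c • x)) + 
      Real.cos (L x + (b + Real.pi / 2)) * (c * k1 i (c • x))) * l j +
    (Real.cos (L x + (b + Real.pi / 2)) * (l i * k1 j (c • x)) + 
      Real.cos (L x + b) * (c * k2 i j (c • x))) * c
  have hid : ∀ n, ∫ ω, ∑ i, X ω i * D1 (c n) i (X ω) ∂P = ∫ ω, ∑ i, ∑ j, S i j * D2 (c n) i j (X ω) ∂P := by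
    intro n
    have hcm : ∀ (a : ℝ) (k : (Fin d → ℝ) → ℝ), ContDiff ℝ (⊤ : ℕ∞) k → 
       ContDiff ℝ (⊤ : ℕ∞) (fun y => Real.cos (L y + a) * k (c n • y)) := by
      intro a k hk
      have := L.contDiff (n := ((⊤ : ℕ∞) : WithTop ℕ∞))
      fun_prop
    have e1 : ∀ j x, fderiv ℝ (fun y => Real.cos (L y + b) * k (c n • y)) x (Pi.single j 1) = D1 (c n) j x :=
      fun j x => cos_prod_hasFDerivAt L b (c n) k hk x _
    have := h (fun y => Real.cos (L y + b) * k (c n • y)) (hcm _ _ hk) 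
      (HasCompactSupport.mul_left (hkc.comp_homeomorph (Homeomorph.smulOfNeZero (c n) (hcpos n).ne')))
    simp_rw [e1] at this
    rw [this]
    congr 1 with ω
    refine Finset.sum_congr rfl fun i _ => Finset.sum_congr rfl fun j _ => ?_
    congr 1
    have e2 : (fun y => D1 (c n) j y) = fun y => l j * (Real.cos (L y + (b + Real.pi / 2)) * k (c n • y)) + 
       c n * (Real.cos (L y + b) * k1 j (c n • y)) := by
      ext y; simp only [D1]; ring
    rw [e2, fderiv_fun_add (((hcm _ _ hk).differentiable (by simp) _).const_mul _)
      (((hcm _ _ (hk1 j)).differentiable (by simp) _).const_mul _),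
      fderiv_const_mul ((hcm _ _ hk).differentiable (by simp) _),
      fderiv_const_mul ((hcm _ _ (hk1 j)).differentiable (by simp) _)]
    simp only [add_apply, smul_apply, smul_eq_mul]
    rw [cos_prod_hasFDerivAt L _ _ _ hk, cos_prod_hasFDerivAt L _ _ _ (hk1 j)]
    simp only [D2, l, k2, k1]
    ring
  have hsm : ∀ x : Fin d → ℝ, Filter.Tendsto (fun n => c n • x) Filter.atTop (nhds 0) := fun x => by
    simpa using hclim.smul_const x
  have hkl : ∀ x, Filter.Tendsto (fun n => k (c n • x)) Filter.atTop (nhds 1) := fun x => by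
    rw [← hk0]; exact (hk.continuous.tendsto 0).comp (hsm x)
  have hk1l : ∀ i x, Filter.Tendsto (fun n => k1 i (c n • x)) Filter.atTop (nhds (k1 i 0)) := fun i x => 
    ((hk1 i).continuous.tendsto 0).comp (hsm x)
  have hk2l : ∀ i j x, Filter.Tendsto (fun n => k2 i j (c n • x)) Filter.atTop (nhds (k2 i j 0)) := fun i j x => 
    ((hk2 i j).continuous.tendsto 0).comp (hsm x)
  have kc := hk.continuous
  have k1c := fun i => (hk1 i).continuous
  have k2c := fun i j => (hk2 i j).continuous
  have D1c : ∀ c i, Continuous (D1 c i) := fun c i => by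
    have := k1c i
    simp only [D1]; fun_prop
  have D2c : ∀ c i j, Continuous (D2 c i j) := fun c i j => by
    have := k1c i
    have := k1c j
    have := k2c i j
    simp only [D2]; fun_prop
  have lim1 : Filter.Tendsto (fun n => ∫ ω, ∑ i, X ω i * D1 (c n) i (X ω) ∂P) Filter.atTop
     (nhds (∫ ω, ∑ i, X ω i * (Real.cos (L (X ω) + (b + Real.pi / 2)) * l i) ∂P)) := by
    refine tendsto_integral_of_dominated_convergence (fun ω => ∑ i, |X ω i| * (|l i| * C0 + C1 i)) ?_ ?_ ?_ ?_
    · intro n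
      refine Measurable.aestronglyMeasurable (Finset.measurable_sum _ fun i _ => ?_)
      exact Measurable.mul (by fun_prop) ((D1c (c n) i).measurable.comp hXmeas)
    · exact integrable_finsetSum _ fun i _ => (hXi i).abs.mul_const _
    · refine fun n => Filter.Eventually.of_forall fun ω => ?_
      refine (Finset.abs_sum_le_sum_abs _ _).trans (Finset.sum_le_sum fun i _ => ?_)
      rw [abs_mul]
      gcongr
      exact abs_bound2 _ _ _ _ _ _ _ _ (Real.abs_cos_le_one _) (Real.abs_cos_le_one _) (hc1 n) (hC0 _) (hC1 i _)
    · refine Filter.Eventually.of_forall fun ω => tendsto_finsetSum _ fun i _ => Filter.Tendsto.const_mul _ ?_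
      have := (((hkl (X ω)).const_mul (l i)).const_mul (Real.cos (L (X ω) + (b + Real.pi / 2)))).add
        ((hclim.mul (hk1l i (X ω))).const_mul (Real.cos (L (X ω) + b)))
      simpa using this
  have lim2 : Filter.Tendsto (fun n => ∫ ω, ∑ i, ∑ j, S i j * D2 (c n) i j (X ω) ∂P) Filter.atTop
     (nhds (∫ ω, ∑ i, ∑ j, S i j * (Real.cos (L (X ω) + (b + Real.pi / 2 + Real.pi / 2)) * l i * l j) ∂P)) := by
    refine tendsto_integral_of_dominated_convergence 
      (fun ω => ∑ i, ∑ j, |S i j| * ((|l i| * C0 + C1 i) * |l j| + (|l i| * C1 j + C2 i j))) ?_ ?_ ?_ ?_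
    · intro n
      refine Measurable.aestronglyMeasurable (Finset.measurable_sum _ fun i _ => Finset.measurable_sum _ fun j _ => ?_)
      exact Measurable.mul (by fun_prop) ((D2c (c n) i j).measurable.comp hXmeas)
    · exact integrable_const _
    · refine fun n => Filter.Eventually.of_forall fun ω => ?_
      refine (Finset.abs_sum_le_sum_abs _ _).trans (Finset.sum_le_sum fun i _ => ?_)
      refine (Finset.abs_sum_le_sum_abs _ _).trans (Finset.sum_le_sum fun j _ => ?_)
      rw [abs_mul]
      gcongr
      refine (abs_add_le _ _).trans (add_le_add ?_ ?_)
      · rw [abs_mul]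
        gcongr
        exact abs_bound2 _ _ _ _ _ _ _ _ (Real.abs_cos_le_one _) (Real.abs_cos_le_one _) (hc1 n) (hC0 _) (hC1 i _)
      · rw [abs_mul]
        refine (mul_le_of_le_one_right (abs_nonneg _) (hc1 n)).trans ?_
        exact abs_bound2 _ _ _ _ _ _ _ _ (Real.abs_cos_le_one _) (Real.abs_cos_le_one _) (hc1 n) (hC1 j _) (hC2 i j _)
    · refine Filter.Eventually.of_forall fun ω => tendsto_finsetSum _ fun i _ => tendsto_finsetSum _ fun j _ => Filter.Tendsto.const_mul _ ?_
      have := (((((hkl (X ω)).const_mul (l i)).const_mul (Real.cos (L (X ω) + (b + Real.pi / 2 + Real.pi / 2)))).add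
        ((hclim.mul (hk1l i (X ω))).const_mul (Real.cos (L (X ω) + (b + Real.pi / 2))))).mul_const (l j)).add
        (((((hk1l j (X ω)).const_mul (l i)).const_mul (Real.cos (L (X ω) + (b + Real.pi / 2)))).add
        ((hclim.mul (hk2l i j (X ω))).const_mul (Real.cos (L (X ω) + b)))).mul hclim)
      simpa using this
  simp_rw [hid] at lim1
  have := tendsto_nhds_unique lim1 lim2
  have a1 : ∀ ω, ∑ i, X ω i * (Real.cos (L (X ω) + (b + Real.pi / 2)) * l i) = 
      Real.cos (L (X ω) + (b + Real.pi / 2)) * L (X ω) := by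
    intro ω
    rw [← fderiv_sum_eq L (X ω), Finset.mul_sum]
    exact Finset.sum_congr rfl fun i _ => by simp only [l, fderiv_sum_eq]; ring
  have a2 : ∀ ω, ∑ i, ∑ j, S i j * (Real.cos (L (X ω) + (b + Real.pi / 2 + Real.pi / 2)) * l i * l j) = 
     - (∑ i, ∑ j, L (Pi.single i 1) * S i j * L (Pi.single j 1)) * Real.cos (L (X ω) + b) := by
    intro ω
    rw [show L (X ω) + (b + Real.pi / 2 + Real.pi / 2) = L (X ω) + b + Real.pi by ring, Real.cos_add_pi,
      neg_mul, ← mul_neg, Finset.sum_mul]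
    refine Finset.sum_congr rfl fun i _ => ?_
    rw [Finset.sum_mul]
    exact Finset.sum_congr rfl fun j _ => by simp only [l]; ring
  simp_rw [a1, a2] at this
  rw [this, integral_const_mul]

lemma ode_solve {Ω : Type*} [MeasurableSpace Ω] (P : Measure Ω) [IsProbabilityMeasure P]
    (Y : Ω → ℝ) (hY : Measurable Y) (hYi : Integrable Y P) (q b : ℝ)
    (h : ∀ t : ℝ, ∫ ω, Real.cos (t * Y ω + (b + Real.pi / 2)) * (t * Y ω) ∂P =
      - (t ^ 2 * q) * ∫ ω, Real.cos (t * Y ω + b) ∂P) :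
    ∫ ω, Real.cos (Y ω + b) ∂P = Real.exp (-(1/2) * q) * Real.cos b := by
  have h0 : ∀ t : ℝ, HasDerivAt (fun t : ℝ => ∫ ω, Real.cos (t * Y ω + b) ∂P)
      (∫ ω, Real.cos (t * Y ω + (b + Real.pi / 2)) * Y ω ∂P) t := by
    intro t
    refine (hasDerivAt_integral_of_dominated_loc_of_deriv_le (μ := P) (s := univ)
      (F := fun (t : ℝ) ω => Real.cos (t * Y ω + b))
      (F' := fun (t : ℝ) ω => Real.cos (t * Y ω + (b + Real.pi / 2)) * Y ω)
      (bound := fun ω => ‖Y ω‖) Filter.univ_mem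
      (Filter.Eventually.of_forall fun t => (by fun_prop : Measurable _).aestronglyMeasurable)
      ?_ (by fun_prop : Measurable _).aestronglyMeasurable ?_ hYi.norm ?_).2
    · apply Integrable.of_bound (C := 1) (by fun_prop : Measurable _).aestronglyMeasurable
      exact Filter.Eventually.of_forall fun ω => Real.abs_cos_le_one _
    · refine Filter.Eventually.of_forall fun ω t _ => ?_
      rw [norm_mul]
      exact mul_le_of_le_one_left (norm_nonneg _) (Real.abs_cos_le_one _)
    · refine Filter.Eventually.of_forall fun ω t _ => ?_
      have h2 : HasDerivAt (fun t : ℝ => t * Y ω + b) (Y ω) t := by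
        simpa using ((hasDerivAt_id t).mul_const (Y ω)).add_const b
      have := h2.cos
      rwa [← add_assoc, Real.cos_add_pi_div_two]
  let G : ℝ → ℝ := fun t => (∫ ω, Real.cos (t * Y ω + b) ∂P) * Real.exp ((1/2) * (t ^ 2 * q))
  have hG : ∀ t, HasDerivAt G ((∫ ω, Real.cos (t * Y ω + (b + Real.pi / 2)) * Y ω ∂P) * Real.exp ((1/2) * (t ^ 2 * q))
     + (∫ ω, Real.cos (t * Y ω + b) ∂P) * (Real.exp ((1/2) * (t ^ 2 * q)) * ((1/2) * (2 * t * q)))) t := by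
    intro t
    have h2 : HasDerivAt (fun t : ℝ => (1/2) * (t ^ 2 * q)) ((1/2) * (2 * t * q)) t := by
      simpa using (((hasDerivAt_id t).pow 2).mul_const q).const_mul (1/2 : ℝ)
    exact (h0 t).mul h2.exp
  obtain ⟨t, ht, hs⟩ := exists_hasDerivAt_eq_slope G _ (zero_lt_one) 
    (fun t _ => (hG t).continuousAt.continuousWithinAt) (fun t _ => hG t)
  have ht0 : t ≠ 0 := ht.1.ne'
  have e : ∫ ω, Real.cos (t * Y ω + (b + Real.pi / 2)) * Y ω ∂P = - (t * q) * ∫ ω, Real.cos (t * Y ω + b) ∂P := by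
    have h1 := h t
    have : ∀ ω, Real.cos (t * Y ω + (b + Real.pi / 2)) * (t * Y ω) = t * (Real.cos (t * Y ω + (b + Real.pi / 2)) * Y ω) :=
      fun ω => by ring
    simp_rw [this] at h1
    rw [integral_const_mul] at h1
    apply mul_left_cancel₀ ht0
    rw [h1]; ring
  rw [e] at hs
  have h1 : G 1 = G 0 := by
    have : (G 1 - G 0) / (1 - 0) = 0 := by rw [← hs]; ring
    rw [sub_zero, div_one] at this
    linarith
  simp only [G] at h1
  simp at h1
  rw [← h1, mul_comm, mul_assoc, ← Real.exp_add]
  simp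

theorem stmt_11 {Ω : Type*} [MeasurableSpace Ω] (P : Measure Ω) [IsProbabilityMeasure P]
    (d : ℕ) (X : Ω → (Fin d → ℝ)) (hXmeas : Measurable X)
    (hX2 : Integrable (fun ω => ∑ i, (X ω i) ^ 2) P)
    (S : Matrix (Fin d) (Fin d) ℝ) (hS : S.PosSemidef) :
    (∀ θ : Fin d → ℝ,
        (∫ ω, Complex.exp (Complex.I * ((∑ i, θ i * X ω i : ℝ) : ℂ)) ∂P) =
          Complex.exp (-(1/2 : ℂ) * ((∑ i, ∑ j, θ i * S i j * θ j : ℝ) : ℂ))) ↔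
      (∀ f : (Fin d → ℝ) → ℝ, ContDiff ℝ (⊤ : ℕ∞) f → HasCompactSupport f →
        (∫ ω, ∑ i, X ω i * fderiv ℝ f (X ω) (Pi.single i 1) ∂P) =
          ∫ ω, ∑ i, ∑ j, S i j *
            fderiv ℝ (fun y => fderiv ℝ f y (Pi.single j 1)) (X ω) (Pi.single i 1) ∂P) := by
  refine ⟨fun h f hf hc => forward P d X hXmeas hX2 S h f hf hc, fun h θ => ?_⟩
  have hXi := coord_integrable P d X hXmeas hX2
  set Y : Ω → ℝ := fun ω => ∑ i, θ i * X ω i with hYd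
  have hY : Measurable Y := by simp only [hYd]; fun_prop
  have hYi : Integrable Y P := integrable_finsetSum _ fun i _ => (hXi i).const_mul _
  set q : ℝ := ∑ i, ∑ j, θ i * S i j * θ j with hq
  let L : ℝ → (Fin d → ℝ) →L[ℝ] ℝ := fun t => t • ∑ i, θ i • ContinuousLinearMap.proj i
  have hL : ∀ t x, L t x = t * ∑ i, θ i * x i := fun t x => by
    simp [L]
  have hLs : ∀ t i, L t (Pi.single i 1) = t * θ i := fun t i => by
    rw [hL]; simp [Pi.single_apply]
  have hb : ∀ b, ∫ ω, Real.cos (Y ω + b) ∂P = Real.exp (-(1/2) * q) * Real.cos b := by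
    intro b
    refine ode_solve P Y hY hYi q b fun t => ?_
    have := limit_ident P d X hXmeas hX2 S h (L t) b
    simp_rw [hLs, hL] at this
    rw [this]
    congr 2
    simp only [hq, Finset.mul_sum]
    exact Finset.sum_congr rfl fun i _ => Finset.sum_congr rfl fun j _ => by ring
  have hcos := hb 0
  have hsin := hb (-(Real.pi / 2))
  simp only [← sub_eq_add_neg, Real.cos_sub_pi_div_two, Real.cos_neg, Real.cos_pi_div_two, mul_zero, add_zero, Real.cos_zero, mul_one] at hcos hsin
  have hic : Integrable (fun ω => Real.cos (Y ω)) P :=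
    Integrable.of_bound (C := 1) (by fun_prop : Measurable _).aestronglyMeasurable
      (Filter.Eventually.of_forall fun ω => Real.abs_cos_le_one _)
  have his : Integrable (fun ω => Real.sin (Y ω)) P :=
    Integrable.of_bound (C := 1) (by fun_prop : Measurable _).aestronglyMeasurable
      (Filter.Eventually.of_forall fun ω => Real.abs_sin_le_one _)
  have he : ∀ ω, Complex.exp (Complex.I * (Y ω : ℂ)) = 
      ((Real.cos (Y ω) : ℝ) : ℂ) + ((Real.sin (Y ω) : ℝ) : ℂ) * Complex.I := fun ω => by
    rw [mul_comm, Complex.exp_mul_I]; push_cast; rfl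
  change ∫ ω, Complex.exp (Complex.I * (Y ω : ℂ)) ∂P = Complex.exp (-(1/2:ℂ) * (q:ℂ))
  simp_rw [he]
  rw [integral_add hic.ofReal (his.ofReal.mul_const _), integral_mul_const, integral_complex_ofReal, integral_complex_ofReal,
    hcos, hsin]
  push_cast
  simp
end

section
/- Let Z be a real random variable such that for all θ ∈ ℝ, i·E[Z e^{iθZ}] = −cθ·E[e^{iθZ}] for some constant c. Then c ≥ 0 and Z ~ N(0, c). -/
open MeasureTheory ProbabilityTheory

/-- If an integrable real random variable `Z` satisfies
`i·E[Z e^{iθZ}] = -cθ·E[e^{iθZ}]` for all `θ ∈ ℝ` and some constant `c`, then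
`c ≥ 0` and `Z ~ N(0,c)`. -/
theorem stmt_13 {Ω : Type*} [MeasurableSpace Ω] (P : Measure Ω) [IsProbabilityMeasure P]
    (Z : Ω → ℝ) (hZmeas : Measurable Z) (hZint : Integrable Z P) (c : ℝ)
    (h : ∀ θ : ℝ,
      Complex.I * ∫ ω, (Z ω : ℂ) * Complex.exp (Complex.I * (θ * Z ω : ℝ)) ∂P =
        -(c : ℂ) * (θ : ℂ) * ∫ ω, Complex.exp (Complex.I * (θ * Z ω : ℝ)) ∂P) :
    0 ≤ c ∧ Measure.map Z P = gaussianReal 0 c.toNNReal := by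
  have hμ : IsProbabilityMeasure (Measure.map Z P) :=
    Measure.isProbabilityMeasure_map hZmeas.aemeasurable
  have hmem : MemLp id ((1 : ℕ) : ENNReal) (Measure.map Z P) := by
    rw [Nat.cast_one, memLp_one_iff_integrable]
    rw [integrable_map_measure aestronglyMeasurable_id hZmeas.aemeasurable]
    exact hZint
  have hcf : ∀ t : ℝ, charFun (Measure.map Z P) t =
      ∫ ω, Complex.exp (Complex.I * (t * Z ω : ℝ)) ∂P := by
    intro t
    rw [charFun_apply_real, integral_map hZmeas.aemeasurable (by fun_prop)]
    congr 1
    ext ω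
    push_cast
    ring_nf
  have hdiff : Differentiable ℝ (charFun (Measure.map Z P)) :=
    (contDiff_charFun hmem).differentiable (by simp)
  have hderiv : ∀ t : ℝ, HasDerivAt (charFun (Measure.map Z P))
      (-(c : ℂ) * t * charFun (Measure.map Z P) t) t := by
    intro t
    have h1 := (hdiff t).hasDerivAt
    have h2 := iteratedDeriv_charFun (t := t) hmem
    rw [iteratedDeriv_one, integral_map hZmeas.aemeasurable (by fun_prop)] at h2
    rw [h2] at h1
    rw [hcf t, ← h t]
    refine h1.congr_deriv ?_
    rw [pow_one]
    congr 2
    ext ω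
    push_cast
    ring_nf
  have hexp : ∀ t : ℝ, HasDerivAt (fun t : ℝ => Complex.exp ((c : ℂ) * t ^ 2 / 2))
      (Complex.exp ((c : ℂ) * t ^ 2 / 2) * (c * t)) t := by
    intro t
    have h1 : HasDerivAt (fun t : ℝ => (t : ℂ)) 1 t := Complex.ofRealCLM.hasDerivAt
    have h2 := (((h1.pow 2).const_mul (c : ℂ)).div_const 2).cexp
    refine h2.congr_deriv ?_
    simp only [Pi.pow_apply]
    push_cast
    ring
  have hconst : ∀ t : ℝ, charFun (Measure.map Z P) t * Complex.exp ((c : ℂ) * t ^ 2 / 2) = 1 := by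
    intro t
    have hd : ∀ t : ℝ, HasDerivAt (fun t : ℝ => charFun (Measure.map Z P) t *
        Complex.exp ((c : ℂ) * t ^ 2 / 2)) 0 t := by
      intro t
      refine ((hderiv t).mul (hexp t)).congr_deriv ?_
      ring
    have := is_const_of_deriv_eq_zero (fun t => (hd t).differentiableAt)
      (fun t => (hd t).deriv) t 0
    simpa using this
  have hform : ∀ t : ℝ, charFun (Measure.map Z P) t = Complex.exp (-((c : ℂ) * t ^ 2 / 2)) := by
    intro t
    rw [Complex.exp_neg]
    exact eq_inv_of_mul_eq_one_left (hconst t)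
  have hc : 0 ≤ c := by
    have h1 := norm_charFun_le_one (μ := Measure.map Z P) (1 : ℝ)
    rw [hform, Complex.norm_exp, Real.exp_le_one_iff] at h1
    have h2 : (-((c : ℂ) * ((1 : ℝ) : ℂ) ^ 2 / 2)) = ((-(c / 2) : ℝ) : ℂ) := by
      push_cast
      ring
    rw [h2, Complex.ofReal_re] at h1
    linarith
  refine ⟨hc, Measure.ext_of_charFun ?_⟩
  ext t
  rw [hform, charFun_gaussianReal, Real.coe_toNNReal c hc]
  congr 1
  push_cast
  ring
end
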